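/- Let s > 0, let a, b ∈ ℝ, let T ≥ |a − b|/s, and let B ⊆ ℝ be a finite union of closed bounded intervals. For c ∈ ℝ with (|a − c| + |c − b|)/s ≤ T, define γ_c : [0,T] → ℝ as the path that moves from a to c at speed exactly s (i.e. linearly, during [0, |a−c|/s]), stays at c during [|a−c|/s, T − |c−b|/s], and then moves from c to b at speed exactly s (linearly, during [T − |c−b|/s, T]). Then there exists such a c for which the occupation time of γ_c in B equals the infimum, over all s-Lipschitz γ : [0,T] → ℝ with γ(0) = a and γ(T) = b, of the occupation time of γ in B. (Structure of optimal traversals: there is always an optimal traversal consisting of at most two segments of maximal absolute slope and at most one horizontal segment; this is the core structural claim in the paper's analysis of the slab cost function f(λ_{i−1}, λ_i), whose obstacles within a slab are axis-parallel rectangles and hence reduce to a fixed union of intervals B on the Q-axis.) -/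

import Mathlib

open MeasureTheory Set
open scoped ENNReal

/-- `γ` is an `s`-Lipschitz traversal on the time interval `[0, T]`. -/
def IsSLip (s T : ℝ) (γ : ℝ → ℝ) : Prop :=
  ∀ t ∈ Set.Icc (0:ℝ) T, ∀ t' ∈ Set.Icc (0:ℝ) T, |γ t - γ t'| ≤ s * |t - t'|

/-- Occupation time of `γ` in the set `B` during `[0, T]`. -/
noncomputable def occupation (T : ℝ) (γ : ℝ → ℝ) (B : Set ℝ) : ℝ≥0∞ :=
  volume {t ∈ Set.Icc (0:ℝ) T | γ t ∈ B}

/-- The traversal that moves from `a` to `c` at speed exactly `s` during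
`[0, |a−c|/s]`, waits at `c` during `[|a−c|/s, T − |c−b|/s]`, and then moves from
`c` to `b` at speed exactly `s` during `[T − |c−b|/s, T]`. -/
noncomputable def pathVia (s T a b c : ℝ) : ℝ → ℝ := fun t =>
  if t ≤ |a - c| / s then a + t * s * Real.sign (c - a)
  else if t ≤ T - |c - b| / s then c
  else c + (t - (T - |c - b| / s)) * s * Real.sign (b - c)

/-- A real function which is `k`-Lipschitz on `E` expands Lebesgue measure of `E` by at most `k`. -/
theorem volume_image_le_of_lipschitz {f : ℝ → ℝ} {E : Set ℝ} {k : ℝ} (hk : 0 ≤ k)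
    (hf : ∀ x ∈ E, ∀ y ∈ E, |f x - f y| ≤ k * |x - y|) :
    volume (f '' E) ≤ ENNReal.ofReal k * volume E := by
  have hL : LipschitzOnWith k.toNNReal f E := by
    refine LipschitzOnWith.of_dist_le_mul fun x hx y hy => ?_
    simpa [Real.dist_eq, Real.coe_toNNReal k hk] using hf x hx y hy
  have h := hL.hausdorffMeasure_image_le (d := 1) zero_le_one
  rw [hausdorffMeasure_real] at h
  simpa [ENNReal.ofReal] using h

/-- An `s`-Lipschitz path spends at least time `volume (B ∩ [[γ u, γ v]]) / s` in `B` during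
`[u, v]`. -/
theorem IsSLip.volume_inter_uIcc_le {s T : ℝ} {γ : ℝ → ℝ} (hs : 0 < s) (hγ : IsSLip s T γ)
    {u v : ℝ} (hu : 0 ≤ u) (huv : u ≤ v) (hv : v ≤ T) (B : Set ℝ) :
    ENNReal.ofReal s⁻¹ * volume (B ∩ uIcc (γ u) (γ v)) ≤
      volume {t ∈ Icc u v | γ t ∈ B} := by
  have hsub : Icc u v ⊆ Icc 0 T := Icc_subset_Icc hu hv
  have hcont : ContinuousOn γ (Icc u v) := by
    have hL : LipschitzOnWith s.toNNReal γ (Icc u v) := by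
      refine LipschitzOnWith.of_dist_le_mul fun x hx y hy => ?_
      simpa [Real.dist_eq, Real.coe_toNNReal s hs.le] using hγ x (hsub hx) y (hsub hy)
    exact hL.continuousOn
  have himg : B ∩ uIcc (γ u) (γ v) ⊆ γ '' {t ∈ Icc u v | γ t ∈ B} := by
    rintro x ⟨hxB, hx⟩
    have hivt := intermediate_value_uIcc (a := u) (b := v) (f := γ) (by rwa [uIcc_of_le huv])
    obtain ⟨t, ht, rfl⟩ := hivt hx
    rw [uIcc_of_le huv] at ht
    exact ⟨t, ⟨ht, hxB⟩, rfl⟩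
  calc ENNReal.ofReal s⁻¹ * volume (B ∩ uIcc (γ u) (γ v))
      ≤ ENNReal.ofReal s⁻¹ * (ENNReal.ofReal s * volume {t ∈ Icc u v | γ t ∈ B}) := by
        gcongr
        exact (measure_mono himg).trans (volume_image_le_of_lipschitz hs.le
          fun x hx y hy => hγ x (hsub hx.1) y (hsub hy.1))
    _ = volume {t ∈ Icc u v | γ t ∈ B} := by
        rw [← mul_assoc, ← ENNReal.ofReal_mul (by positivity), inv_mul_cancel₀ hs.ne',
          ENNReal.ofReal_one, one_mul]

/-- The length of `B` along the two monotone legs `a → c` and `c → b`. -/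
noncomputable def legMeasure (a b : ℝ) (B : Set ℝ) (c : ℝ) : ℝ≥0∞ :=
  volume (B ∩ uIcc a c) + volume (B ∩ uIcc c b)

/-- A path visiting `γ t ∉ B` occupies `B` at least as long as it takes to traverse the two
legs through `γ t` at full speed. -/
theorem IsSLip.legMeasure_le_occupation {s T : ℝ} {γ : ℝ → ℝ} (hs : 0 < s)
    (hγ : IsSLip s T γ) {B : Set ℝ} {t : ℝ} (ht : t ∈ Icc 0 T) (hB : γ t ∉ B) :
    ENNReal.ofReal s⁻¹ * legMeasure (γ 0) (γ T) B (γ t) ≤ occupation T γ B := by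
  rw [legMeasure, mul_add, occupation,
    ← measure_inter_add_sdiff {t ∈ Icc 0 T | γ t ∈ B} (measurableSet_Iio (a := t))]
  refine add_le_add ((hγ.volume_inter_uIcc_le hs le_rfl ht.1 ht.2 B).trans (measure_mono ?_))
    ((hγ.volume_inter_uIcc_le hs ht.1 ht.2 le_rfl B).trans (measure_mono ?_))
  · rintro x ⟨hx, hxB⟩
    refine ⟨⟨⟨hx.1, hx.2.trans ht.2⟩, hxB⟩, lt_of_le_of_ne hx.2 ?_⟩
    rintro rfl
    exact hB hxB
  · rintro x ⟨hx, hxB⟩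
    exact ⟨⟨⟨ht.1.trans hx.1, hx.2⟩, hxB⟩, not_lt.2 hx.1⟩

theorem abs_mul_sign_sub (x y : ℝ) : |x - y| * Real.sign (y - x) = y - x := by
  rcases lt_trichotomy x y with h | rfl | h
  · rw [Real.sign_of_pos (sub_pos.2 h), abs_of_neg (sub_neg.2 h)]; ring
  · simp
  · rw [Real.sign_of_neg (sub_neg.2 h), abs_of_pos (sub_pos.2 h)]; ring

/-- A closed form of `pathVia` that separates the outgoing and the incoming leg. -/
theorem pathVia_eq {s T a b c : ℝ} (hs : 0 < s) (hc : (|a - c| + |c - b|) / s ≤ T) (t : ℝ) :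
    pathVia s T a b c t = a + s * Real.sign (c - a) * min t (|a - c| / s) +
      s * Real.sign (b - c) * max 0 (t - (T - |c - b| / s)) := by
  have h12 : |a - c| / s ≤ T - |c - b| / s := by rw [add_div] at hc; linarith
  have hleg : a + s * Real.sign (c - a) * (|a - c| / s) = c := by
    have := abs_mul_sign_sub a c
    field_simp
    linarith
  unfold pathVia
  split_ifs with h1 h2
  · rw [min_eq_left h1, max_eq_left (by linarith)]; ring
  · rw [min_eq_right (not_le.1 h1).le, max_eq_left (by linarith), hleg]; ring
  · rw [min_eq_right (not_le.1 h1).le, max_eq_right (by linarith), hleg]; ring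

theorem abs_mul_sign_mul_le {s : ℝ} (hs : 0 < s) (x d : ℝ) (hd : 0 ≤ d) :
    |s * Real.sign x * d| ≤ s * d := by
  rw [abs_mul, abs_mul, abs_of_pos hs, abs_of_nonneg hd]
  have : |Real.sign x| ≤ 1 := by
    rcases Real.sign_apply_eq x with h | h | h <;> simp [h]
  nlinarith [mul_nonneg hs.le hd]

theorem isSLip_pathVia {s T a b c : ℝ} (hs : 0 < s) (hc : (|a - c| + |c - b|) / s ≤ T) :
    IsSLip s T (pathVia s T a b c) := by
  have h12 : |a - c| / s ≤ T - |c - b| / s := by rw [add_div] at hc; linarith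
  have key : ∀ t t' : ℝ, t' ≤ t →
      |pathVia s T a b c t - pathVia s T a b c t'| ≤ s * |t - t'| := by
    intro t t' htt
    rw [pathVia_eq hs hc, pathVia_eq hs hc, abs_of_nonneg (sub_nonneg.2 htt)]
    set u := |a - c| / s
    set v := T - |c - b| / s
    have hmin : 0 ≤ min t u - min t' u := sub_nonneg.2 (min_le_min_right _ htt)
    have hmax : 0 ≤ max 0 (t - v) - max 0 (t' - v) :=
      sub_nonneg.2 (max_le_max_left _ (by linarith))
    have hsum : (min t u - min t' u) + (max 0 (t - v) - max 0 (t' - v)) ≤ t - t' := by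
      grind
    calc _ = |s * Real.sign (c - a) * (min t u - min t' u) +
          s * Real.sign (b - c) * (max 0 (t - v) - max 0 (t' - v))| := by ring_nf
      _ ≤ s * (min t u - min t' u) + s * (max 0 (t - v) - max 0 (t' - v)) :=
        (abs_add_le _ _).trans (add_le_add (abs_mul_sign_mul_le hs _ _ hmin)
          (abs_mul_sign_mul_le hs _ _ hmax))
      _ ≤ s * (t - t') := by rw [← mul_add]; gcongr
  intro t _ t' _
  rcases le_total t' t with h | h
  · exact key t t' h
  · rw [abs_sub_comm, abs_sub_comm t]
    exact key t' t h

theorem pathVia_zero {s T a b c : ℝ} (hs : 0 < s) : pathVia s T a b c 0 = a := by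
  unfold pathVia
  rw [if_pos (by positivity)]
  ring

theorem pathVia_end {s T a b c : ℝ} (hs : 0 < s) (hc : (|a - c| + |c - b|) / s ≤ T) :
    pathVia s T a b c T = b := by
  have hcb : 0 ≤ |c - b| / s := by positivity
  have hac := abs_mul_sign_sub a c
  have hb := abs_mul_sign_sub c b
  rw [pathVia_eq hs hc, min_eq_right (by rw [add_div] at hc; linarith),
    max_eq_right (by linarith)]
  field_simp
  ring_nf at hac hb ⊢
  linarith

/-- The path through `c ∉ B` occupies `B` only along its two legs of maximal slope. -/
theorem occupation_pathVia_le {s T a b c : ℝ} (hs : 0 < s) {B : Set ℝ} (hcB : c ∉ B) :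
    occupation T (pathVia s T a b c) B ≤ ENNReal.ofReal s⁻¹ * legMeasure a b B c := by
  have himg (D : Set ℝ) (k x₀ : ℝ) :
      volume ((fun x => k + |x - x₀| / s) '' D) ≤ ENNReal.ofReal s⁻¹ * volume D := by
    refine volume_image_le_of_lipschitz (by positivity) fun x _ y _ => ?_
    have : k + |x - x₀| / s - (k + |y - x₀| / s) = s⁻¹ * (|x - x₀| - |y - x₀|) := by ring
    rw [this, abs_mul, abs_of_pos (inv_pos.2 hs)]
    refine mul_le_mul_of_nonneg_left ?_ (inv_pos.2 hs).le
    simpa using abs_abs_sub_abs_le (x - x₀) (y - x₀)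
  -- A point at time `r` on a full-speed leg from `x` to `y`.
  have hleg (x y r : ℝ) (hr : 0 ≤ r) (hr' : r ≤ |x - y| / s) (hxy : x ≠ y) :
      x + r * s * Real.sign (y - x) ∈ uIcc x y ∧
        r = |x + r * s * Real.sign (y - x) - x| / s := by
    have hrs : r * s ≤ |x - y| := (le_div_iff₀ hs).1 hr'
    have hrs0 : 0 ≤ r * s := by positivity
    rcases lt_or_gt_of_ne hxy with h | h
    · rw [Real.sign_of_pos (sub_pos.2 h), mul_one, add_sub_cancel_left, abs_of_nonneg hrs0]
      rw [abs_of_neg (sub_neg.2 h)] at hrs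
      exact ⟨by rw [uIcc_of_le h.le]; constructor <;> linarith, by field_simp⟩
    · rw [Real.sign_of_neg (sub_neg.2 h), mul_neg_one, add_sub_cancel_left, abs_neg,
        abs_of_nonneg hrs0]
      rw [abs_of_pos (sub_pos.2 h)] at hrs
      exact ⟨by rw [uIcc_of_ge h.le]; constructor <;> linarith, by field_simp⟩
  have hsub : {t ∈ Icc 0 T | pathVia s T a b c t ∈ B} ⊆
      (fun x => 0 + |x - a| / s) '' (B ∩ uIcc a c) ∪
        (fun x => (T - |c - b| / s) + |x - c| / s) '' (B ∩ uIcc c b) := by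
    rintro t ⟨ht, htB⟩
    unfold pathVia at htB
    split_ifs at htB with h1 h2
    · have hne : a ≠ c := by
        rintro rfl
        exact hcB (by simpa using htB)
      obtain ⟨h3, h4⟩ := hleg a c t ht.1 h1 hne
      exact Or.inl ⟨_, ⟨htB, h3⟩, (zero_add _).trans h4.symm⟩
    · exact absurd htB hcB
    · have hne : c ≠ b := by
        rintro rfl
        exact hcB (by simpa using htB)
      obtain ⟨h3, h4⟩ := hleg c b (t - (T - |c - b| / s)) (by linarith) (by linarith [ht.2]) hne
      refine Or.inr ⟨_, ⟨htB, h3⟩, ?_⟩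
      change _ + _ = t
      linarith
  rw [legMeasure, mul_add, occupation]
  exact (measure_mono hsub).trans ((measure_union_le _ _).trans
    (add_le_add (himg _ _ _) (himg _ _ _)))

theorem legMeasure_eq_of_inter_eq_empty {a b c c' : ℝ} {B : Set ℝ}
    (h : B ∩ uIcc c c' = ∅) : legMeasure a b B c = legMeasure a b B c' := by
  have h' : ∀ x ∈ B, x ∉ uIcc c c' := fun x hx hx' => (h ▸ ⟨hx, hx'⟩ : x ∈ (∅ : Set ℝ))
  unfold legMeasure
  congr 2 <;>
  · ext x
    refine and_congr_right fun hx => ?_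
    have := h' x hx
    simp only [mem_uIcc] at this ⊢
    grind

/-- Two points outside a finite union of intervals lying to the right of the same left endpoints
are not separated by the union. -/
theorem inter_uIcc_eq_empty {I : Finset (ℝ × ℝ)} {c c' : ℝ}
    (hc : c ∉ ⋃ p ∈ I, Icc p.1 p.2) (hc' : c' ∉ ⋃ p ∈ I, Icc p.1 p.2)
    (h : I.filter (fun p => p.1 < c) = I.filter (fun p => p.1 < c')) :
    (⋃ p ∈ I, Icc p.1 p.2) ∩ uIcc c c' = ∅ := by
  rw [eq_empty_iff_forall_notMem]
  rintro x ⟨hx, hxc⟩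
  simp only [mem_iUnion, exists_prop, mem_Icc, not_exists, not_and] at hx hc hc'
  obtain ⟨p, hp, hpx⟩ := hx
  have h1 := hc p hp
  have h2 := hc' p hp
  have h3 : p.1 < c ↔ p.1 < c' := by
    have := Finset.ext_iff.1 h p
    simpa [hp] using this
  rw [mem_uIcc] at hxc
  grind

/-- On the complement of a finite union of intervals, `legMeasure` takes finitely many values. -/
theorem finite_image_legMeasure (a b : ℝ) (I : Finset (ℝ × ℝ)) {S : Set ℝ}
    (hS : ∀ c ∈ S, c ∉ ⋃ p ∈ I, Icc p.1 p.2) :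
    (legMeasure a b (⋃ p ∈ I, Icc p.1 p.2) '' S).Finite := by
  set key : ℝ → Finset (ℝ × ℝ) := fun c => I.filter (fun p => p.1 < c)
  have hfin : (key '' S).Finite :=
    I.powerset.finite_toSet.subset (by
      rintro _ ⟨c, -, rfl⟩
      exact Finset.mem_coe.2 (Finset.mem_powerset.2 (Finset.filter_subset _ _)))
  obtain ⟨R, hRS, hR⟩ := (surjOn_image key S).exists_bijOn_subset
  have hRfin : R.Finite := hR.finite_iff_finite.2 hfin
  refine (hRfin.image (legMeasure a b (⋃ p ∈ I, Icc p.1 p.2))).subset ?_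
  rintro _ ⟨c, hc, rfl⟩
  obtain ⟨r, hr, hrc⟩ := hR.surjOn (mem_image_of_mem key hc)
  exact ⟨r, hr, legMeasure_eq_of_inter_eq_empty
    (inter_uIcc_eq_empty (hS r (hRS hr)) (hS c hc) hrc)⟩

/-- Structure of optimal traversals: if the obstacle set `B` is a finite union of
closed bounded intervals, then some traversal consisting of at most two segments of
maximal absolute slope and at most one horizontal segment attains the optimal
occupation time among all `s`-Lipschitz traversals from `a` to `b`. -/
theorem optimal_traversal_three_segments
    (s T a b : ℝ) (hs : 0 < s) (hT : |a - b| / s ≤ T)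
    (I : Finset (ℝ × ℝ)) (B : Set ℝ) (hB : B = ⋃ p ∈ I, Set.Icc p.1 p.2) :
    ∃ c : ℝ, (|a - c| + |c - b|) / s ≤ T ∧
      occupation T (pathVia s T a b c) B =
        sInf {x : ℝ≥0∞ | ∃ γ : ℝ → ℝ, IsSLip s T γ ∧ γ 0 = a ∧ γ T = b ∧
          x = occupation T γ B} := by
  subst hB
  set B := ⋃ p ∈ I, Icc p.1 p.2
  set S : Set ℝ := {c | (|a - c| + |c - b|) / s ≤ T ∧ c ∉ B}
  have hT0 : 0 ≤ T := le_trans (by positivity) hT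
  obtain ⟨c, hc, hle⟩ : ∃ c : ℝ, (|a - c| + |c - b|) / s ≤ T ∧ ∀ c' ∈ S,
      occupation T (pathVia s T a b c) B ≤ ENNReal.ofReal s⁻¹ * legMeasure a b B c' := by
    rcases S.eq_empty_or_nonempty with hS | hS
    · exact ⟨a, by simpa using hT, by simp [hS]⟩
    · obtain ⟨_, ⟨c, hcS, rfl⟩, hmin⟩ :=
        (finite_image_legMeasure a b I (S := S) fun c hc => hc.2).exists_minimal (hS.image _)
      refine ⟨c, hcS.1, fun c' hc' => (occupation_pathVia_le hs hcS.2).trans ?_⟩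
      gcongr
      exact (le_total _ _).elim id (hmin (mem_image_of_mem _ hc'))
  refine ⟨c, hc, le_antisymm (le_sInf ?_)
    (sInf_le ⟨_, isSLip_pathVia hs hc, pathVia_zero hs, pathVia_end hs hc, rfl⟩)⟩
  rintro _ ⟨γ, hγ, rfl, rfl, rfl⟩
  by_cases hγB : ∀ t ∈ Icc 0 T, γ t ∈ B
  · exact measure_mono fun t ht => ⟨ht.1, hγB t ht.1⟩
  · push Not at hγB
    obtain ⟨t, ht, htB⟩ := hγB
    refine (hle (γ t) ⟨?_, htB⟩).trans (hγ.legMeasure_le_occupation hs ht htB)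
    have h1 := hγ 0 ⟨le_rfl, hT0⟩ t ht
    have h2 := hγ t ht T ⟨hT0, le_rfl⟩
    rw [abs_sub_comm 0 t, sub_zero, abs_of_nonneg ht.1] at h1
    rw [abs_sub_comm t T, abs_of_nonneg (sub_nonneg.2 ht.2)] at h2
    rw [div_le_iff₀ hs]
    linarith
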